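/- Let G be a thin spider graph of weight r ≥ 2, i.e., V(G) is partitioned into S = {s_1,…,s_r}, C = {c_1,…,c_r}, and H (possibly empty), where S is a stable set, C is a clique, every vertex of H is adjacent to every vertex of C, no vertex of H is adjacent to any vertex of S, and s_i is adjacent to c_j if and only if i = j. Then γ_gr^t(G) = γ_gr^t(G[H]) + 2r, where G[H] is the subgraph of G induced by H. -/

import Mathlib

/-- `s` is a legal (open neighborhood) sequence in `G`. -/
def IsLegalSeq {V : Type*} (G : SimpleGraph V) (s : List V) : Prop :=
  s.Nodup ∧ ∀ i : Fin s.length, ∃ w : V, G.Adj (s.get i) w ∧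
    ∀ j : Fin s.length, (j : ℕ) < (i : ℕ) → ¬ G.Adj (s.get j) w

/-- The Grundy total domination number: the maximum length of a legal sequence. -/
noncomputable def grundyTotal {V : Type*} (G : SimpleGraph V) : ℕ :=
  sSup {n | ∃ s : List V, IsLegalSeq G s ∧ s.length = n}

/-- A list of pairs (vertex, footprinted neighbor): every second entry is adjacent to its first
entry and to no earlier first entry. -/
def IsFootprintList {V : Type*} (G : SimpleGraph V) (L : List (V × V)) : Prop :=
  (∀ p ∈ L, G.Adj p.1 p.2) ∧ L.Pairwise fun p q => ¬ G.Adj p.1 q.2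

namespace IsFootprintList

variable {V : Type*} {G : SimpleGraph V} {L : List (V × V)}

theorem sublist (hL : IsFootprintList G L) {L' : List (V × V)} (h : L'.Sublist L) :
    IsFootprintList G L' :=
  ⟨fun p hp => hL.1 p (h.subset hp), hL.2.sublist h⟩

theorem nodup_fst (hL : IsFootprintList G L) : (L.map Prod.fst).Nodup := by
  refine List.pairwise_map.2 (hL.2.imp_of_mem fun {p q} _ hq hpq he => hpq ?_)
  rw [he]
  exact hL.1 q hq

theorem nodup_snd (hL : IsFootprintList G L) : (L.map Prod.snd).Nodup := by
  refine List.pairwise_map.2 (hL.2.imp_of_mem fun {p q} hp _ hpq he => hpq ?_)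
  rw [← he]
  exact hL.1 p hp

theorem isLegalSeq (hL : IsFootprintList G L) : IsLegalSeq G (L.map Prod.fst) := by
  refine ⟨hL.nodup_fst, fun i => ?_⟩
  have hi : (i : ℕ) < L.length := by simpa using i.2
  refine ⟨L[(i : ℕ)].2, by simpa using hL.1 _ (List.getElem_mem hi), fun j hj => ?_⟩
  simpa using List.pairwise_iff_getElem.1 hL.2 j i (hj.trans hi) hi hj

end IsFootprintList

theorem IsLegalSeq.exists_isFootprintList {V : Type*} {G : SimpleGraph V} {l : List V}
    (hl : IsLegalSeq G l) : ∃ L, IsFootprintList G L ∧ L.length = l.length := by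
  choose w hw hlt using hl.2
  refine ⟨(List.finRange l.length).map fun i => (l.get i, w i), ⟨?_, ?_⟩, by simp⟩
  · intro p hp
    obtain ⟨i, -, rfl⟩ := List.mem_map.1 hp
    exact hw i
  · exact List.pairwise_map.2 ((List.pairwise_lt_finRange _).imp fun {i j} hij => hlt j i hij)

theorem bddAbove_length_isLegalSeq {V : Type*} [Finite V] (G : SimpleGraph V) :
    BddAbove {n | ∃ l : List V, IsLegalSeq G l ∧ l.length = n} := by
  have := Fintype.ofFinite V
  refine ⟨Fintype.card V, ?_⟩
  rintro n ⟨l, hl, rfl⟩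
  exact hl.1.length_le_card

theorem IsFootprintList.length_le_grundyTotal {V : Type*} [Finite V] {G : SimpleGraph V}
    {L : List (V × V)} (hL : IsFootprintList G L) : L.length ≤ grundyTotal G :=
  le_csSup (bddAbove_length_isLegalSeq G) ⟨_, hL.isLegalSeq, by simp⟩

theorem exists_isFootprintList_length_eq_grundyTotal {V : Type*} [Finite V]
    (G : SimpleGraph V) : ∃ L, IsFootprintList G L ∧ L.length = grundyTotal G := by
  obtain ⟨l, hl, hlen⟩ := Nat.sSup_mem (s := {n | ∃ l : List V, IsLegalSeq G l ∧ l.length = n})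
    ⟨0, [], by simp [IsLegalSeq], rfl⟩ (bddAbove_length_isLegalSeq G)
  obtain ⟨L, hL, hLl⟩ := hl.exists_isFootprintList
  exact ⟨L, hL, hLl.trans hlen⟩

theorem isFootprintList_map_val_iff {V : Type*} {G : SimpleGraph V} {H : Set V}
    {L : List (H × H)} :
    IsFootprintList G (L.map (Prod.map Subtype.val Subtype.val)) ↔
      IsFootprintList (G.induce H) L := by
  simp only [IsFootprintList, List.pairwise_map, List.forall_mem_map, Prod.map_fst, Prod.map_snd,
    SimpleGraph.comap_adj, Function.Embedding.subtype_apply, SimpleGraph.induce]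

theorem IsFootprintList.length_le_grundyTotal_induce {V : Type*} [Finite V]
    {G : SimpleGraph V} {H : Set V} {L : List (V × V)} (hL : IsFootprintList G L)
    (hH : ∀ p ∈ L, p.1 ∈ H ∧ p.2 ∈ H) : L.length ≤ grundyTotal (G.induce H) := by
  have hmem : L ∈ Set.range (List.map (Prod.map (Subtype.val : H → V) (Subtype.val : H → V))) := by
    rw [Set.range_list_map]
    exact fun p hp => ⟨(⟨p.1, (hH p hp).1⟩, ⟨p.2, (hH p hp).2⟩), rfl⟩
  obtain ⟨L', rfl⟩ := hmem
  simpa using (isFootprintList_map_val_iff.1 hL).length_le_grundyTotal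

theorem List.Nodup.length_le_of_forall_mem_range {α : Type*} {n : ℕ} {f : Fin n → α}
    {l : List α} (hl : l.Nodup) (h : ∀ x ∈ l, x ∈ Set.range f) : l.length ≤ n := by
  have hsub : l ⊆ (List.finRange n).map f := fun x hx => by
    obtain ⟨i, rfl⟩ := h x hx
    exact List.mem_map_of_mem (List.mem_finRange i)
  simpa using (hl.subperm hsub).length_le

theorem List.length_le_length_filter_add {α : Type*} (p q t : α → Bool) (l : List α)
    (h : ∀ x ∈ l, p x ∨ q x ∨ t x) :
    l.length ≤ (l.filter p).length + (l.filter q).length + (l.filter t).length := by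
  induction l with
  | nil => simp
  | cons a l ih =>
    have := ih fun x hx => h x (List.mem_cons_of_mem a hx)
    have ha := h a List.mem_cons_self
    grind

theorem grundyTotal_thin_spider {V : Type*} [Fintype V] (G : SimpleGraph V)
    (r : ℕ) (hr : 2 ≤ r) (s c : Fin r → V) (H : Set V)
    -- the parts S = range s, C = range c and H form a partition of V(G):
    (hs : Function.Injective s) (hc : Function.Injective c)
    (hsc : ∀ i j, s i ≠ c j)
    (hsH : ∀ i, s i ∉ H) (hcH : ∀ i, c i ∉ H)
    (hcover : ∀ v : V, (∃ i, v = s i) ∨ (∃ i, v = c i) ∨ v ∈ H)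
    -- S is a stable set:
    (hstable : ∀ i j, ¬ G.Adj (s i) (s j))
    -- C is a clique:
    (hclique : ∀ i j, i ≠ j → G.Adj (c i) (c j))
    -- H is completely joined to C:
    (hHC : ∀ v ∈ H, ∀ i, G.Adj v (c i))
    -- no vertex of H is adjacent to a vertex of S:
    (hHS : ∀ v ∈ H, ∀ i, ¬ G.Adj v (s i))
    -- thin spider condition:
    (hthin : ∀ i j, G.Adj (s i) (c j) ↔ i = j) :
    grundyTotal G = grundyTotal (G.induce H) + 2 * r := by
  classical
  have hSC : ∀ i j, G.Adj (s i) (c j) → i = j := fun i j => (hthin i j).1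
  apply le_antisymm
  · obtain ⟨L, hL, hlen⟩ := exists_isFootprintList_length_eq_grundyTotal G
    have hcases : ∀ p ∈ L, p.1 ∈ Set.range c ∨ p.2 ∈ Set.range c ∨ p.1 ∈ H ∧ p.2 ∈ H := by
      intro p hp
      have hadj := hL.1 p hp
      rcases hcover p.1 with ⟨i, hi⟩ | ⟨i, hi⟩ | h1
      · rcases hcover p.2 with ⟨j, hj⟩ | ⟨j, hj⟩ | h2
        · exact absurd (hi ▸ hj ▸ hadj) (hstable i j)
        · exact Or.inr (Or.inl ⟨j, hj.symm⟩)
        · exact absurd (hi ▸ hadj).symm (hHS _ h2 i)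
      · exact Or.inl ⟨i, hi.symm⟩
      · rcases hcover p.2 with ⟨j, hj⟩ | ⟨j, hj⟩ | h2
        · exact absurd (hj ▸ hadj) (hHS _ h1 j)
        · exact Or.inr (Or.inl ⟨j, hj.symm⟩)
        · exact Or.inr (Or.inr ⟨h1, h2⟩)
    have hsplit := L.length_le_length_filter_add (fun p => decide (p.1 ∈ Set.range c))
      (fun p => decide (p.2 ∈ Set.range c)) (fun p => decide (p.1 ∈ H ∧ p.2 ∈ H))
      (by simpa only [decide_eq_true_eq] using hcases)
    have hfst : (L.filter fun p => decide (p.1 ∈ Set.range c)).length ≤ r := by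
      rw [← List.length_map Prod.fst]
      refine (hL.sublist List.filter_sublist).nodup_fst.length_le_of_forall_mem_range
        (f := c) fun x hx => ?_
      obtain ⟨p, hp, rfl⟩ := List.mem_map.1 hx
      exact of_decide_eq_true (List.mem_filter.1 hp).2
    have hsnd : (L.filter fun p => decide (p.2 ∈ Set.range c)).length ≤ r := by
      rw [← List.length_map Prod.snd]
      refine (hL.sublist List.filter_sublist).nodup_snd.length_le_of_forall_mem_range
        (f := c) fun x hx => ?_
      obtain ⟨p, hp, rfl⟩ := List.mem_map.1 hx
      exact of_decide_eq_true (List.mem_filter.1 hp).2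
    have hind := (hL.sublist (List.filter_sublist
      (p := fun p => decide (p.1 ∈ H ∧ p.2 ∈ H)))).length_le_grundyTotal_induce (H := H)
      fun p hp => of_decide_eq_true (List.mem_filter.1 hp).2
    omega
  · obtain ⟨L, hL, hlen⟩ := exists_isFootprintList_length_eq_grundyTotal (G.induce H)
    have hL' := isFootprintList_map_val_iff.2 hL
    have hfoot : IsFootprintList G ((List.finRange r).map (fun i => (s i, c i)) ++
        (L.map (Prod.map Subtype.val Subtype.val) ++
          (List.finRange r).map fun i => (c i, s i))) := by
      refine ⟨fun p hp => ?_, List.pairwise_append.2 ⟨?_, List.pairwise_append.2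
        ⟨hL'.2, ?_, ?_⟩, ?_⟩⟩
      · rcases List.mem_append.1 hp with hp | hp
        · obtain ⟨i, -, rfl⟩ := List.mem_map.1 hp
          exact (hthin i i).2 rfl
        · rcases List.mem_append.1 hp with hp | hp
          · exact hL'.1 p hp
          · obtain ⟨i, -, rfl⟩ := List.mem_map.1 hp
            exact ((hthin i i).2 rfl).symm
      · exact List.pairwise_map.2 ((List.nodup_finRange r).imp fun hij h => hij (hSC _ _ h))
      · exact List.pairwise_map.2
          ((List.nodup_finRange r).imp fun hij h => hij (hSC _ _ h.symm).symm)
      · intro p hp q hq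
        obtain ⟨p, -, rfl⟩ := List.mem_map.1 hp
        obtain ⟨i, -, rfl⟩ := List.mem_map.1 hq
        exact hHS _ p.1.2 i
      · intro p hp q hq
        obtain ⟨i, -, rfl⟩ := List.mem_map.1 hp
        rcases List.mem_append.1 hq with hq | hq
        · obtain ⟨q, -, rfl⟩ := List.mem_map.1 hq
          exact fun h => hHS _ q.2.2 i h.symm
        · obtain ⟨j, -, rfl⟩ := List.mem_map.1 hq
          exact hstable i j
    have hle := hfoot.length_le_grundyTotal
    simp only [List.length_append, List.length_map, List.length_finRange] at hle
    omega
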